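/- Let q₁ and q₂ be non-degenerate quadratic forms over ℚ of the same rank and p a prime. Suppose q₁ ⊗ ℚ_ℓ ≅ q₂ ⊗ ℚ_ℓ for all primes ℓ ≠ p, and suppose the common discriminant of q₁ and q₂ is positive. Then 4 divides s₋(q₁) if and only if ε_p(q₁) = ε_ℝ(q₂)·ε_p(q₂). -/

import Mathlib

noncomputable section

open Classical in
/-- The Hilbert symbol over a field `K`: it is `1` if the conic
`z² = a x² + b y²` has a nontrivial solution over `K`, and `-1` otherwise. -/
def hilbertSym (K : Type*) [Field K] (a b : K) : ℤ :=
  if ∃ x y z : K, (x, y, z) ≠ (0, 0, 0) ∧ z ^ 2 = a * x ^ 2 + b * y ^ 2 then 1 else -1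

/-- The Hasse–Witt invariant `ε(q) = ∏_{i<j} (a_i, a_j)` of the diagonal quadratic
form `⟨a 0, …, a (n-1)⟩` over `K`. -/
def hasseInv (K : Type*) [Field K] {n : ℕ} (a : Fin n → K) : ℤ :=
  ∏ i : Fin n, ∏ j : Fin n, if i < j then hilbertSym K (a i) (a j) else 1

instance (q : Nat.Primes) : Fact (Nat.Prime (q : ℕ)) := ⟨q.2⟩

/-- Hasse invariant at the real place. -/
def epsReal {n : ℕ} (a : Fin n → ℚ) : ℤ :=
  hasseInv ℝ fun i => (a i : ℝ)

/-- Hasse invariant at a finite place `q`. -/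
def epsP {n : ℕ} (a : Fin n → ℚ) (q : Nat.Primes) : ℤ :=
  hasseInv ℚ_[(q : ℕ)] fun i => (a i : ℚ_[(q : ℕ)])

/-- negative index `s₋` of the diagonal rational quadratic form. -/
def negIndex {n : ℕ} (a : Fin n → ℚ) : ℕ :=
  (Finset.univ.filter fun i => a i < 0).card

/-- The rational diagonal forms `⟨a i⟩` and `⟨b i⟩` become equivalent over `ℚ_ℓ`. -/
def EquivAt {n : ℕ} (a b : Fin n → ℚ) (q : Nat.Primes) : Prop :=
  (QuadraticMap.weightedSumSquares ℚ_[(q : ℕ)] fun i => (a i : ℚ_[(q : ℕ)])).Equivalent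
    (QuadraticMap.weightedSumSquares ℚ_[(q : ℕ)] fun i => (b i : ℚ_[(q : ℕ)]))

section HilbertSymbol

variable {K : Type*} [Field K]

lemma hilbertSym_eq_one_iff {a b : K} : hilbertSym K a b = 1 ↔
    ∃ x y z : K, (x, y, z) ≠ (0, 0, 0) ∧ z ^ 2 = a * x ^ 2 + b * y ^ 2 := by
  unfold hilbertSym
  split_ifs with h
  · exact ⟨fun _ => h, fun _ => rfl⟩
  · exact ⟨fun h' => absurd h' (by norm_num), fun h' => absurd h' h⟩

lemma hilbertSym_eq_neg_one_iff {a b : K} : hilbertSym K a b = -1 ↔ ¬ hilbertSym K a b = 1 := by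
  unfold hilbertSym
  split_ifs <;> simp

lemma hilbertSym_eq_one_or_neg_one (a b : K) : hilbertSym K a b = 1 ∨ hilbertSym K a b = -1 := by
  rw [hilbertSym_eq_neg_one_iff]
  exact em _

lemma hilbertSym_mul_self (a b : K) : hilbertSym K a b * hilbertSym K a b = 1 := by
  rcases hilbertSym_eq_one_or_neg_one a b with h | h <;> simp [h]

lemma hilbertSym_congr {a b c d : K} (h : hilbertSym K a b = 1 ↔ hilbertSym K c d = 1) :
    hilbertSym K a b = hilbertSym K c d := by
  rcases hilbertSym_eq_one_or_neg_one a b with h1 | h1 <;>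
  rcases hilbertSym_eq_one_or_neg_one c d with h2 | h2 <;> simp_all

lemma hilbertSym_comm (a b : K) : hilbertSym K a b = hilbertSym K b a := by
  have key : ∀ a b : K, hilbertSym K a b = 1 → hilbertSym K b a = 1 := by
    intro a b h
    rw [hilbertSym_eq_one_iff] at h ⊢
    obtain ⟨x, y, z, h0, h⟩ := h
    refine ⟨y, x, z, ?_, by rw [h]; ring⟩
    simp only [ne_eq, Prod.mk.injEq] at h0 ⊢
    tauto
  exact hilbertSym_congr ⟨key a b, key b a⟩

lemma hilbertSym_mul_sq_left (a b : K) {c : K} (hc : c ≠ 0) :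
    hilbertSym K (a * c ^ 2) b = hilbertSym K a b := by
  apply hilbertSym_congr
  simp only [hilbertSym_eq_one_iff]
  constructor
  · rintro ⟨x, y, z, h0, h⟩
    refine ⟨c * x, y, z, ?_, by rw [h]; ring⟩
    simpa [hc] using h0
  · rintro ⟨x, y, z, h0, h⟩
    refine ⟨c⁻¹ * x, y, z, ?_, by rw [h]; field_simp⟩
    simpa [hc] using h0

lemma hilbertSym_mul_sq_right (a b : K) {c : K} (hc : c ≠ 0) :
    hilbertSym K a (b * c ^ 2) = hilbertSym K a b := by
  rw [hilbertSym_comm, hilbertSym_mul_sq_left _ _ hc, hilbertSym_comm]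

lemma hilbertSym_eq_one_of_eq {a b x y : K} (h : a = x ^ 2 - b * y ^ 2) :
    hilbertSym K a b = 1 :=
  hilbertSym_eq_one_iff.mpr ⟨1, y, x, by simp, by rw [h]; ring⟩

lemma hilbertSym_neg_self_left (b : K) : hilbertSym K (-b) b = 1 :=
  hilbertSym_eq_one_of_eq (x := 0) (y := 1) (by ring)

lemma hilbertSym_sq_left {c : K} (b : K) : hilbertSym K (c ^ 2) b = 1 :=
  hilbertSym_eq_one_of_eq (x := c) (y := 0) (by ring)

lemma hilbertSym_one_left (b : K) : hilbertSym K 1 b = 1 := by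
  simpa using hilbertSym_sq_left (c := 1) b

lemma exists_norm_of_hilbertSym_eq_one [NeZero (2 : K)] {a b : K} (hb0 : b ≠ 0)
    (h : hilbertSym K a b = 1) :
    ∃ x y : K, a = x ^ 2 - b * y ^ 2 := by
  obtain ⟨x, y, z, h0, h⟩ := hilbertSym_eq_one_iff.mp h
  have h2 : (2 : K) ≠ 0 := NeZero.ne 2
  by_cases hx : x = 0
  · subst hx
    have hy : y ≠ 0 := by
      rintro rfl
      simp_all
    have hb : b = (z / y) ^ 2 := by
      field_simp
      linear_combination -h
    have hz : z ≠ 0 := by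
      rintro rfl
      simp [hb] at hb0
    refine ⟨(a + 1) / 2, (a - 1) / (2 * (z / y)), ?_⟩
    rw [hb]
    field_simp
    ring
  · refine ⟨z / x, y / x, ?_⟩
    field_simp
    linear_combination -h

lemma hilbertSym_mul_eq_one [NeZero (2 : K)] {a a' b : K} (hb : b ≠ 0)
    (h : hilbertSym K a b = 1) (h' : hilbertSym K a' b = 1) : hilbertSym K (a * a') b = 1 := by
  obtain ⟨x, y, rfl⟩ := exists_norm_of_hilbertSym_eq_one hb h
  obtain ⟨x', y', rfl⟩ := exists_norm_of_hilbertSym_eq_one hb h'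
  exact hilbertSym_eq_one_of_eq (x := x * x' + b * y * y') (y := x * y' + x' * y) (by ring)

lemma hilbertSym_mul_of_eq_one [NeZero (2 : K)] {a a' b : K} (ha : a ≠ 0) (hb : b ≠ 0)
    (h : hilbertSym K a b = 1) : hilbertSym K (a * a') b = hilbertSym K a' b := by
  refine hilbertSym_congr ⟨fun h' => ?_, hilbertSym_mul_eq_one hb h⟩
  have := hilbertSym_mul_eq_one hb h h'
  rwa [show a * (a * a') = a' * a ^ 2 by ring, hilbertSym_mul_sq_left _ _ ha] at this

/-- The Hilbert symbol of `K` is multiplicative in its first argument. -/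
def HilbertMultiplicative (K : Type*) [Field K] : Prop :=
  ∀ a a' b : K, a ≠ 0 → a' ≠ 0 → b ≠ 0 →
    hilbertSym K (a * a') b = hilbertSym K a b * hilbertSym K a' b

lemma hilbertMultiplicative_of_neg_one [NeZero (2 : K)]
    (H : ∀ a a' b : K, a ≠ 0 → a' ≠ 0 → b ≠ 0 → hilbertSym K a b = -1 →
      hilbertSym K a' b = -1 → hilbertSym K (a * a') b = 1) : HilbertMultiplicative K := by
  intro a a' b ha ha' hb
  rcases hilbertSym_eq_one_or_neg_one a b with h | h
  · rw [hilbertSym_mul_of_eq_one ha hb h, h, one_mul]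
  rcases hilbertSym_eq_one_or_neg_one a' b with h' | h'
  · rw [mul_comm, hilbertSym_mul_of_eq_one ha' hb h', h', mul_one]
  · rw [H a a' b ha ha' hb h h', h, h']
    norm_num

lemma HilbertMultiplicative.mul_right (hK : HilbertMultiplicative K) {a b b' : K} (ha : a ≠ 0)
    (hb : b ≠ 0) (hb' : b' ≠ 0) :
    hilbertSym K a (b * b') = hilbertSym K a b * hilbertSym K a b' := by
  rw [hilbertSym_comm, hK b b' a hb hb' ha, hilbertSym_comm, hilbertSym_comm a b']

lemma HilbertMultiplicative.prod_right (hK : HilbertMultiplicative K) {ι : Type*} (s : Finset ι)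
    {a : K} {b : ι → K} (ha : a ≠ 0) (hb : ∀ i, b i ≠ 0) :
    hilbertSym K a (∏ i ∈ s, b i) = ∏ i ∈ s, hilbertSym K a (b i) := by
  classical
  induction s using Finset.induction_on with
  | empty => simp [hilbertSym_comm a 1, hilbertSym_one_left]
  | insert i s hi ih =>
    rw [Finset.prod_insert hi, Finset.prod_insert hi,
      hK.mul_right ha (hb i) (Finset.prod_ne_zero_iff.mpr fun j _ => hb j), ih]

end HilbertSymbol

section HasseInvariant

variable {K : Type*} [Field K]

lemma hasseInv_cons {n : ℕ} (c : K) (a : Fin n → K) :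
    hasseInv K (Fin.cons c a : Fin (n + 1) → K) = (∏ i, hilbertSym K c (a i)) * hasseInv K a := by
  simp [hasseInv, Fin.prod_univ_succ]

lemma hasseInv_cons_eq (hK : HilbertMultiplicative K) {n : ℕ} {c : K} {a : Fin n → K}
    (hc : c ≠ 0) (ha : ∀ i, a i ≠ 0) :
    hasseInv K (Fin.cons c a : Fin (n + 1) → K) = hilbertSym K c (∏ i, a i) * hasseInv K a := by
  rw [hasseInv_cons, hK.prod_right _ hc ha]

/-- Some linear map pulls the diagonal form `⟨b i⟩` back to `⟨a i⟩`. -/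
def DiagEmbeds {n : ℕ} (a b : Fin n → K) : Prop :=
  ∃ L : (Fin n → K) →ₗ[K] (Fin n → K), ∀ x, ∑ i, b i * L x i ^ 2 = ∑ i, a i * x i ^ 2

lemma DiagEmbeds.refl {n : ℕ} (a : Fin n → K) : DiagEmbeds a a :=
  ⟨LinearMap.id, fun _ => rfl⟩

lemma DiagEmbeds.trans {n : ℕ} {a b c : Fin n → K} (h : DiagEmbeds a b) (h' : DiagEmbeds b c) :
    DiagEmbeds a c := by
  obtain ⟨L, hL⟩ := h
  obtain ⟨M, hM⟩ := h'
  exact ⟨M ∘ₗ L, fun x => by rw [← hL, ← hM]; rfl⟩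

lemma DiagEmbeds.cons {n : ℕ} {a b : Fin n → K} (h : DiagEmbeds a b) (c d : K) :
    DiagEmbeds (Fin.cons (c * d ^ 2) a : Fin (n + 1) → K) (Fin.cons c b) := by
  obtain ⟨L, hL⟩ := h
  refine ⟨LinearMap.pi (Fin.cons (d • LinearMap.proj 0) fun i =>
    LinearMap.proj i ∘ₗ L ∘ₗ LinearMap.funLeft K K Fin.succ), fun x => ?_⟩
  have := hL (LinearMap.funLeft K K Fin.succ x)
  simp [Fin.sum_univ_succ, this, LinearMap.funLeft_apply]
  ring

lemma diagEmbeds_binary {n : ℕ} (a₁ a₂ x y : K) (c : Fin n → K) 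
    (hd : a₁ * x ^ 2 + a₂ * y ^ 2 ≠ 0) :
    DiagEmbeds (Fin.cons a₁ (Fin.cons a₂ c) : Fin (n + 2) → K)
      (Fin.cons (a₁ * x ^ 2 + a₂ * y ^ 2)
        (Fin.cons (a₁ * a₂ * (a₁ * x ^ 2 + a₂ * y ^ 2)) c)) := by
  set d := a₁ * x ^ 2 + a₂ * y ^ 2 with hdef
  refine ⟨LinearMap.pi (Fin.cons
    ((a₁ * x / d) • LinearMap.proj 0 + (a₂ * y / d) • LinearMap.proj 1)
    (Fin.cons ((y / d) • LinearMap.proj 0 - (x / d) • LinearMap.proj 1)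
      fun i => LinearMap.proj i.succ.succ)), fun v => ?_⟩
  simp only [Fin.sum_univ_succ, LinearMap.pi_apply, Fin.cons_zero, Fin.cons_succ,
    LinearMap.add_apply, LinearMap.sub_apply, LinearMap.smul_apply, LinearMap.proj_apply,
    smul_eq_mul, ← add_assoc]
  congr 1
  have : (1 : Fin (n + 2)) = Fin.succ 0 := rfl
  rw [this]
  field_simp
  rw [hdef]
  ring

lemma DiagEmbeds.polar [NeZero (2 : K)] {n : ℕ} {a b : Fin n → K}
    {L : (Fin n → K) →ₗ[K] (Fin n → K)}
    (hL : ∀ x, ∑ i, b i * L x i ^ 2 = ∑ i, a i * x i ^ 2) (x y : Fin n → K) :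
    ∑ i, b i * (L x i * L y i) = ∑ i, a i * (x i * y i) := by
  have h2 : (2 : K) ≠ 0 := NeZero.ne 2
  have h := hL (x + y)
  have e : ∀ (c u v : Fin n → K), ∑ i, c i * (u i + v i) ^ 2 =
      ∑ i, c i * u i ^ 2 + ∑ i, c i * v i ^ 2 + 2 * ∑ i, c i * (u i * v i) := by
    intro c u v
    rw [Finset.mul_sum, ← Finset.sum_add_distrib, ← Finset.sum_add_distrib]
    exact Finset.sum_congr rfl fun i _ => by ring
  simp only [map_add, Pi.add_apply, e, hL] at h
  exact mul_left_cancel₀ h2 (by linear_combination h)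

lemma DiagEmbeds.exists_det [NeZero (2 : K)] {n : ℕ} {a b : Fin n → K} (h : DiagEmbeds a b) :
    ∃ r : K, ∏ i, a i = (∏ i, b i) * r ^ 2 := by
  obtain ⟨L, hL⟩ := h
  refine ⟨(LinearMap.toMatrix' L).det, ?_⟩
  have : (LinearMap.toMatrix' L).transpose * Matrix.diagonal b * LinearMap.toMatrix' L =
      Matrix.diagonal a := by
    ext i j
    have := DiagEmbeds.polar hL (Pi.single i 1) (Pi.single j 1)
    rw [Matrix.mul_apply]
    simp only [Matrix.mul_diagonal, Matrix.transpose_apply, LinearMap.toMatrix'_apply]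
    rw [show Matrix.diagonal a i j = ∑ k, a k *
      ((Pi.single i 1 : Fin n → K) k * (Pi.single j 1 : Fin n → K) k) by
        simp [Pi.single_apply, Matrix.diagonal_apply, eq_comm (a := i) (b := j)]; grind, ← this]
    exact Finset.sum_congr rfl fun k _ => by ring
  have := congrArg Matrix.det this
  rw [Matrix.det_mul, Matrix.det_mul, Matrix.det_transpose, Matrix.det_diagonal,
    Matrix.det_diagonal] at this
  rw [← this]
  ring

/-- Witt cancellation for diagonal forms. -/
lemma DiagEmbeds.cancel [NeZero (2 : K)] {n : ℕ} {a b : Fin n → K} {c : K}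
    (h : DiagEmbeds (Fin.cons c a : Fin (n + 1) → K) (Fin.cons c b)) : DiagEmbeds a b := by
  obtain ⟨L, hL⟩ := h
  have h2 : (2 : K) ≠ 0 := NeZero.ne 2
  set e : Fin (n + 1) → K := Fin.cons 1 0 with he
  set s := L e 0 with hs
  obtain ⟨σ, hσ, hσs⟩ : ∃ σ : K, σ ^ 2 = 1 ∧ 1 + σ * s ≠ 0 := by
    by_cases h1 : 1 + s = 0
    · refine ⟨-1, by ring, fun h3 => h2 ?_⟩
      linear_combination h1 + h3
    · exact ⟨1, by ring, by rwa [one_mul]⟩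
  set ι : (Fin n → K) →ₗ[K] (Fin (n + 1) → K) :=
    LinearMap.pi (Fin.cons 0 fun i => LinearMap.proj i) with hι
  have hι0 : ∀ x, ι x 0 = 0 := fun x => by simp [hι]
  have hιs : ∀ x i, ι x (Fin.succ i) = x i := fun x i => by simp [hι]
  refine ⟨LinearMap.pi fun i => LinearMap.proj i.succ ∘ₗ L ∘ₗ ι -
    (σ * L e i.succ / (1 + σ * s)) • (LinearMap.proj 0 ∘ₗ L ∘ₗ ι), fun x => ?_⟩
  have hee := hL e
  have hxx := hL (ι x)
  have hex := DiagEmbeds.polar hL e (ι x)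
  simp only [Fin.sum_univ_succ, Fin.cons_zero, Fin.cons_succ, hι0, hιs, he, Pi.zero_apply]
    at hee hxx hex
  rw [← he, ← hs] at hee hex
  simp only [LinearMap.pi_apply, LinearMap.sub_apply, LinearMap.comp_apply, LinearMap.proj_apply,
    LinearMap.smul_apply, smul_eq_mul]
  set t := L (ι x) 0
  have expand : ∑ i, b i * (L (ι x) i.succ - σ * L e i.succ / (1 + σ * s) * t) ^ 2 =
      ∑ i, b i * L (ι x) i.succ ^ 2
        - 2 * (σ * t / (1 + σ * s)) * ∑ i, b i * (L e i.succ * L (ι x) i.succ)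
        + (σ * t / (1 + σ * s)) ^ 2 * ∑ i, b i * L e i.succ ^ 2 := by
    rw [Finset.mul_sum, Finset.mul_sum, ← Finset.sum_sub_distrib, ← Finset.sum_add_distrib]
    exact Finset.sum_congr rfl fun i _ => by ring
  rw [expand]
  simp at hee hxx hex
  rw [eq_sub_of_add_eq' hee, eq_sub_of_add_eq' hxx, eq_sub_of_add_eq' hex]
  field_simp
  linear_combination c * t ^ 2 * hσ

lemma hilbertSym_binary [NeZero (2 : K)] (hK : HilbertMultiplicative K) {a₁ a₂ x y : K}
    (h₁ : a₁ ≠ 0) (h₂ : a₂ ≠ 0) (hd : a₁ * x ^ 2 + a₂ * y ^ 2 ≠ 0) :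
    hilbertSym K (a₁ * x ^ 2 + a₂ * y ^ 2) (a₁ * a₂ * (a₁ * x ^ 2 + a₂ * y ^ 2)) =
      hilbertSym K a₁ a₂ := by
  set d := a₁ * x ^ 2 + a₂ * y ^ 2 with hdef
  have h12 : a₁ * a₂ ≠ 0 := mul_ne_zero h₁ h₂
  have e1 : hilbertSym K d (a₁ * a₂ * d) = hilbertSym K d (-(a₁ * a₂)) := by
    rw [show a₁ * a₂ * d = -(a₁ * a₂) * -d by ring, hK.mul_right hd (neg_ne_zero.mpr h12)
      (neg_ne_zero.mpr hd), hilbertSym_comm d (-d), hilbertSym_neg_self_left, mul_one]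
  have e2 : hilbertSym K (a₁ * d) (-(a₁ * a₂)) = 1 :=
    hilbertSym_eq_one_of_eq (x := a₁ * x) (y := y) (by rw [hdef]; ring)
  have e3 : hilbertSym K a₁ (-(a₁ * a₂)) = hilbertSym K a₁ a₂ := by
    rw [show -(a₁ * a₂) = -a₁ * a₂ by ring, hK.mul_right h₁ (neg_ne_zero.mpr h₁) h₂,
      hilbertSym_comm a₁ (-a₁), hilbertSym_neg_self_left, one_mul]
  rw [e1, ← e3]
  rw [hK a₁ d _ h₁ hd (neg_ne_zero.mpr h12)] at e2
  rcases hilbertSym_eq_one_or_neg_one a₁ (-(a₁ * a₂)) with h | h <;>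
  rw [h] at e2 ⊢ <;> linarith

/-- A nonzero value `d` of a diagonal form splits off, preserving the Hasse invariant. -/
lemma exists_diagEmbeds_cons [NeZero (2 : K)] (hK : HilbertMultiplicative K) {n : ℕ}
    (a x : Fin (n + 1) → K) (ha : ∀ i, a i ≠ 0) (hd : ∑ i, a i * x i ^ 2 ≠ 0) :
      ∃ c : Fin n → K, (∀ i, c i ≠ 0) ∧ DiagEmbeds a (Fin.cons (∑ i, a i * x i ^ 2) c) ∧
        hasseInv K a = hasseInv K (Fin.cons (∑ i, a i * x i ^ 2) c : Fin (n + 1) → K) := by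
  induction n with
  | zero =>
    refine ⟨Fin.elim0, fun i => i.elim0, ?_, by simp [hasseInv]⟩
    simp only [Fin.sum_univ_succ, Finset.univ_eq_empty, Finset.sum_empty, add_zero] at hd ⊢
    have hx : x 0 ≠ 0 := by
      intro h
      simp [h] at hd
    have h := (DiagEmbeds.refl (Fin.elim0 : Fin 0 → K)).cons (a 0 * x 0 ^ 2) (x 0)⁻¹
    rw [show a 0 * x 0 ^ 2 * (x 0)⁻¹ ^ 2 = a 0 by field_simp] at h
    convert h using 1
    ext i
    fin_cases i
    rfl
  | succ n ih =>
    obtain ⟨a₀, a, rfl⟩ : ∃ c d, a = Fin.cons c d := ⟨a 0, Fin.tail a, (Fin.cons_self_tail a).symm⟩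
    have ha₀ : a₀ ≠ 0 := ha 0
    replace ha : ∀ i, a i ≠ 0 := fun i => ha i.succ
    rw [Fin.sum_univ_succ] at hd ⊢
    simp only [Fin.cons_zero, Fin.cons_succ] at hd ⊢
    by_cases hd' : ∑ i, a i * x i.succ ^ 2 = 0
    · rw [hd', add_zero] at hd ⊢
      have hx : x 0 ≠ 0 := by
        intro h
        simp [h] at hd
      have h := (DiagEmbeds.refl a).cons (a₀ * x 0 ^ 2) (x 0)⁻¹
      rw [show a₀ * x 0 ^ 2 * (x 0)⁻¹ ^ 2 = a₀ by field_simp] at h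
      refine ⟨a, ha, h, ?_⟩
      rw [hasseInv_cons_eq hK ha₀ ha, hasseInv_cons_eq hK hd ha, hilbertSym_mul_sq_left _ _ hx]
    · obtain ⟨c, hc, hac, hε⟩ := ih a (fun i => x i.succ) ha hd'
      obtain ⟨r, hr⟩ := hac.exists_det
      set d' := ∑ i, a i * x i.succ ^ 2
      have hr0 : r ≠ 0 := by
        rintro rfl
        exact Finset.prod_ne_zero_iff.mpr (fun i _ => ha i) (by simpa using hr)
      have h1 := hac.cons a₀ 1
      have h2 := diagEmbeds_binary a₀ d' (x 0) 1 c (by simpa using hd)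
      have h3 := hilbertSym_binary (x := x 0) (y := 1) hK ha₀ hd' (by simpa using hd)
      simp only [one_pow, mul_one] at h1 h2 h3
      set d := a₀ * x 0 ^ 2 + d'
      have hc' : ∏ i, c i ≠ 0 := Finset.prod_ne_zero_iff.mpr fun i _ => hc i
      have hadd : a₀ * d' * d ≠ 0 := mul_ne_zero (mul_ne_zero ha₀ hd') hd
      have hcons : ∀ i, (Fin.cons (a₀ * d' * d) c : Fin (n + 1) → K) i ≠ 0 :=
        Fin.cases hadd hc
      refine ⟨Fin.cons (a₀ * d' * d) c, hcons, h1.trans h2, ?_⟩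
      rw [hasseInv_cons_eq hK ha₀ ha, hr, hilbertSym_mul_sq_right _ _ hr0, hε,
        hasseInv_cons_eq hK hd hcons, hasseInv_cons_eq hK hadd hc, hasseInv_cons_eq hK hd' hc]
      simp only [Fin.prod_univ_succ, Fin.cons_zero, Fin.cons_succ]
      rw [hK.mul_right ha₀ hd' hc', hK.mul_right hd hadd hc', h3,
        hK _ _ _ (mul_ne_zero ha₀ hd') hd hc', hK _ _ _ ha₀ hd' hc']
      linear_combination (-hilbertSym K a₀ d' * hilbertSym K a₀ (∏ i, c i) *
        hilbertSym K d' (∏ i, c i) * hasseInv K c) * hilbertSym_mul_self d (∏ i, c i)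

/-- The Hasse invariant is an isometry invariant. -/
theorem DiagEmbeds.hasseInv_eq [NeZero (2 : K)] (hK : HilbertMultiplicative K) {n : ℕ} :
    ∀ {a b : Fin n → K}, (∀ i, a i ≠ 0) → (∀ i, b i ≠ 0) → DiagEmbeds a b →
      hasseInv K a = hasseInv K b := by
  induction n with
  | zero => intro a b _ _ _; simp [hasseInv]
  | succ n ih =>
    intro a b ha hb h
    obtain ⟨a₀, a, rfl⟩ : ∃ c d, a = Fin.cons c d := ⟨a 0, Fin.tail a, (Fin.cons_self_tail a).symm⟩
    have ha₀ : a₀ ≠ 0 := ha 0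
    replace ha : ∀ i, a i ≠ 0 := fun i => ha i.succ
    obtain ⟨L, hL⟩ := id h
    have hx := hL (Fin.cons 1 0)
    simp only [Fin.sum_univ_succ (n := n) (f := fun i => (Fin.cons a₀ a : Fin (n + 1) → K) i * _),
      Fin.cons_zero, Fin.cons_succ, Pi.zero_apply] at hx
    simp only [one_pow, mul_one, ne_eq, OfNat.ofNat_ne_zero, not_false_eq_true, zero_pow, mul_zero,
      Finset.sum_const_zero, add_zero] at hx
    obtain ⟨c, hc, hbc, hε⟩ := exists_diagEmbeds_cons hK b (L (Fin.cons 1 0)) hb (by rwa [hx])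
    rw [hx] at hbc hε
    have hac : DiagEmbeds a c := (h.trans hbc).cancel
    obtain ⟨r, hr⟩ := hac.exists_det
    have hr0 : r ≠ 0 := by
      rintro rfl
      exact Finset.prod_ne_zero_iff.mpr (fun i _ => ha i) (by simpa using hr)
    rw [hε, hasseInv_cons_eq hK ha₀ ha, hasseInv_cons_eq hK ha₀ hc, ih ha hc hac, hr,
      hilbertSym_mul_sq_right _ _ hr0]

end HasseInvariant

section Local

variable {p : ℕ} [Fact p.Prime]

namespace PadicInt

lemma toZMod_eq_zero_iff_norm_lt_one (x : ℤ_[p]) : toZMod x = 0 ↔ ‖x‖ < 1 := by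
  rw [← RingHom.mem_ker, ker_toZMod, IsLocalRing.mem_maximalIdeal, mem_nonunits]

lemma isUnit_iff_toZMod_ne_zero (x : ℤ_[p]) : IsUnit x ↔ toZMod x ≠ 0 := by
  rw [ne_eq, toZMod_eq_zero_iff_norm_lt_one, ← not_isUnit_iff, not_not]

lemma toZMod_unit_ne_zero (u : ℤ_[p]ˣ) : toZMod (u : ℤ_[p]) ≠ 0 :=
  (isUnit_iff_toZMod_ne_zero _).mp u.isUnit

lemma exists_sq_of_norm_one_sub_lt {v : ℤ_[p]} (hv : ‖1 - v‖ < ‖(2 : ℤ_[p])‖ ^ 2) :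
    ∃ z : ℤ_[p], z ^ 2 = v := by
  obtain ⟨z, hz, -⟩ := hensels_lemma (p := p) (R := ℤ_[p]) (F := Polynomial.X ^ 2 - Polynomial.C v)
    (a := 1) (by
      simp only [map_sub, map_pow, Polynomial.aeval_X, Polynomial.aeval_C,
        Polynomial.derivative_C, Polynomial.derivative_X_pow]
      simpa using hv)
  refine ⟨z, ?_⟩
  simpa [sub_eq_zero] using hz

lemma norm_two_of_ne_two (hp : p ≠ 2) : ‖(2 : ℤ_[p])‖ = 1 := by
  have h := norm_natCast_eq_one_iff (p := p) (n := 2)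
  rw [Nat.cast_ofNat] at h
  exact h.mpr ((Nat.coprime_primes Fact.out Nat.prime_two).mpr hp)

lemma exists_sq_of_toZMod_eq_one (hp : p ≠ 2) {v : ℤ_[p]} (hv : toZMod v = 1) :
    ∃ z : ℤ_[p], z ^ 2 = v := by
  apply exists_sq_of_norm_one_sub_lt
  rw [norm_two_of_ne_two hp, one_pow, ← toZMod_eq_zero_iff_norm_lt_one, map_sub, map_one, hv,
    sub_self]

lemma exists_sq_of_toZModPow_three_eq_one {v : ℤ_[2]} (hv : toZModPow 3 v = 1) :
    ∃ z : ℤ_[2], z ^ 2 = v := by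
  apply exists_sq_of_norm_one_sub_lt
  have h : 1 - v ∈ RingHom.ker (toZModPow (p := 2) 3) := by
    rw [RingHom.mem_ker, map_sub, map_one, hv, sub_self]
  rw [ker_toZModPow, ← norm_le_pow_iff_mem_span_pow] at h
  have h2 : ‖(2 : ℤ_[2])‖ = 2⁻¹ := by simpa using norm_p (p := 2)
  rw [h2]
  refine h.trans_lt ?_
  norm_num

end PadicInt

open PadicInt

lemma Padic.exists_unit_mul_sq {a : ℚ_[p]} (ha : a ≠ 0) :
    ∃ (u : ℤ_[p]ˣ) (c : ℚ_[p]), c ≠ 0 ∧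
      (a = ((u : ℤ_[p]) : ℚ_[p]) * c ^ 2 ∨ a = p * ((u : ℤ_[p]) : ℚ_[p]) * c ^ 2) := by
  have hp : (p : ℚ_[p]) ≠ 0 := Nat.cast_ne_zero.mpr (Fact.out : p.Prime).ne_zero
  have hp' : (p : ℝ) ≠ 0 := Nat.cast_ne_zero.mpr (Fact.out : p.Prime).ne_zero
  set n := a.valuation
  have hu : ‖a * (p : ℚ_[p]) ^ (-n)‖ = 1 := by
    rw [norm_mul, Padic.norm_eq_zpow_neg_valuation ha, Padic.norm_p_zpow, neg_neg,
      ← zpow_add₀ hp', neg_add_cancel, zpow_zero]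
  obtain ⟨u, hau⟩ : ∃ u : ℤ_[p]ˣ, a = ((u : ℤ_[p]) : ℚ_[p]) * (p : ℚ_[p]) ^ n :=
    ⟨mkUnits hu, by
      rw [mkUnits_eq, mul_assoc, ← zpow_add₀ hp, neg_add_cancel, zpow_zero, mul_one]⟩
  clear_value n
  rcases Int.even_or_odd' n with ⟨k, hk | hk⟩
  · refine ⟨u, (p : ℚ_[p]) ^ k, zpow_ne_zero _ hp, Or.inl ?_⟩
    rw [← zpow_natCast, ← zpow_mul, hau, hk]
    congr 2
    push_cast
    ring
  · refine ⟨u, (p : ℚ_[p]) ^ k, zpow_ne_zero _ hp, Or.inr ?_⟩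
    rw [← zpow_natCast, ← zpow_mul, mul_comm (p : ℚ_[p]), mul_assoc, ← zpow_one_add₀ hp, hau, hk]
    congr 2
    push_cast
    ring

lemma hilbertSym_eq_one_of_sq {a b x y v : ℤ_[p]} (h : ∃ z : ℤ_[p], z ^ 2 = v) (hv : v ≠ 0)
    (hab : a * x ^ 2 + b * y ^ 2 = v) : hilbertSym ℚ_[p] a b = 1 := by
  obtain ⟨z, rfl⟩ := h
  refine hilbertSym_eq_one_iff.mpr ⟨x, y, z, fun h0 => hv ?_,
    by simpa using congrArg ((↑) : ℤ_[p] → ℚ_[p]) hab.symm⟩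
  simp only [Prod.mk.injEq, coe_eq_zero] at h0
  simp [h0.2.2]

lemma hilbertSym_eq_one_of_toZMod (hp : p ≠ 2) {a b : ℤ_[p]} {x y : ZMod p}
    (h : toZMod a * x ^ 2 + toZMod b * y ^ 2 = 1) : hilbertSym ℚ_[p] a b = 1 := by
  obtain ⟨x, rfl⟩ := ZMod.ringHom_surjective (toZMod (p := p)) x
  obtain ⟨y, rfl⟩ := ZMod.ringHom_surjective (toZMod (p := p)) y
  have h1 : toZMod (a * x ^ 2 + b * y ^ 2) = 1 := by simpa using h
  exact hilbertSym_eq_one_of_sq (exists_sq_of_toZMod_eq_one hp h1)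
    (fun h0 => by simp [h0] at h1) rfl

lemma hilbertSym_two_eq_one {a b : ℤ_[2]} {x y : ZMod (2 ^ 3)}
    (h : toZModPow 3 a * x ^ 2 + toZModPow 3 b * y ^ 2 = 1) : hilbertSym ℚ_[2] a b = 1 := by
  obtain ⟨x, rfl⟩ := ZMod.ringHom_surjective (toZModPow (p := 2) 3) x
  obtain ⟨y, rfl⟩ := ZMod.ringHom_surjective (toZModPow (p := 2) 3) y
  have h1 : toZModPow 3 (a * x ^ 2 + b * y ^ 2) = 1 := by simpa using h
  refine hilbertSym_eq_one_of_sq (exists_sq_of_toZModPow_three_eq_one h1) (fun h0 => ?_) rfl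
  rw [h0, map_zero] at h1
  exact absurd h1 (by decide)

lemma hilbertSym_unit_of_isSquare_toZMod (hp : p ≠ 2) {u : ℤ_[p]} (hu : IsUnit u)
    (h : IsSquare (toZMod u)) (b : ℤ_[p]) : hilbertSym ℚ_[p] u b = 1 := by
  obtain ⟨r, hr⟩ := h
  have hu := (isUnit_iff_toZMod_ne_zero u).mp hu
  have hr0 : r ≠ 0 := by
    rintro rfl
    simp_all
  refine hilbertSym_eq_one_of_toZMod hp (x := r⁻¹) (y := 0) ?_
  rw [hr]
  field_simp
  ring

lemma hilbertSym_units (hp : p ≠ 2) {u v : ℤ_[p]} (hu : IsUnit u) (hv : IsUnit v) :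
    hilbertSym ℚ_[p] u v = 1 := by
  have hu := (isUnit_iff_toZMod_ne_zero u).mp hu
  have hv := (isUnit_iff_toZMod_ne_zero v).mp hv
  have hodd : Fintype.card (ZMod p) % 2 = 1 := by
    rw [ZMod.card]
    exact (Nat.Prime.mod_two_eq_one_iff_ne_two (Fact.out : p.Prime)).mpr hp
  obtain ⟨x, y, h⟩ := FiniteField.exists_root_sum_quadratic
    (f := Polynomial.C (toZMod u) * Polynomial.X ^ 2)
    (g := Polynomial.C (toZMod v) * Polynomial.X ^ 2 + Polynomial.C (-1))
    (Polynomial.degree_C_mul_X_pow 2 hu)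
    (by compute_degree!) hodd
  refine hilbertSym_eq_one_of_toZMod hp (x := x) (y := y) ?_
  simp at h
  linear_combination h

lemma exists_primitive_of_hilbertSym_eq_one {a b : ℤ_[p]} (h : hilbertSym ℚ_[p] a b = 1) :
    ∃ x y z : ℤ_[p], (IsUnit x ∨ IsUnit y ∨ IsUnit z) ∧ z ^ 2 = a * x ^ 2 + b * y ^ 2 := by
  obtain ⟨x, y, z, h0, h⟩ := hilbertSym_eq_one_iff.mp h
  obtain ⟨m, hm0, hx, hy, hz, hm⟩ : ∃ m : ℚ_[p], m ≠ 0 ∧ ‖x‖ ≤ ‖m‖ ∧ ‖y‖ ≤ ‖m‖ ∧ ‖z‖ ≤ ‖m‖ ∧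
      (m = x ∨ m = y ∨ m = z) := by
    have hne : ∀ m : ℚ_[p], ‖x‖ ≤ ‖m‖ → ‖y‖ ≤ ‖m‖ → ‖z‖ ≤ ‖m‖ → m ≠ 0 := by
      rintro _ h1 h2 h3 rfl
      simp only [norm_zero, norm_le_zero_iff] at h1 h2 h3
      simp [h1, h2, h3] at h0
    rcases le_total ‖x‖ ‖y‖ with h1 | h1 <;> rcases le_total ‖y‖ ‖z‖ with h2 | h2 <;>
    rcases le_total ‖x‖ ‖z‖ with h3 | h3
    · exact ⟨z, hne z h3 h2 le_rfl, h3, h2, le_rfl, by simp⟩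
    · exact ⟨z, hne z (h1.trans h2) h2 le_rfl, h1.trans h2, h2, le_rfl, by simp⟩
    · exact ⟨y, hne y h1 le_rfl h2, h1, le_rfl, h2, by simp⟩
    · exact ⟨y, hne y h1 le_rfl h2, h1, le_rfl, h2, by simp⟩
    · exact ⟨z, hne z h3 h2 le_rfl, h3, h2, le_rfl, by simp⟩
    · exact ⟨x, hne x le_rfl h1 h3, le_rfl, h1, h3, by simp⟩
    · exact ⟨x, hne x le_rfl h1 (h2.trans h1), le_rfl, h1, h2.trans h1, by simp⟩
    · exact ⟨x, hne x le_rfl h1 h3, le_rfl, h1, h3, by simp⟩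
  have hdiv : ∀ w : ℚ_[p], ‖w‖ ≤ ‖m‖ → ∃ W : ℤ_[p], (W : ℚ_[p]) = w / m := fun w hw =>
    ⟨⟨w / m, by rw [norm_div]; exact div_le_one_of_le₀ hw (norm_nonneg _)⟩, rfl⟩
  have hone : ∀ (w : ℚ_[p]) (W : ℤ_[p]), (W : ℚ_[p]) = w / m → m = w → IsUnit W := by
    intro w W hW h
    rw [isUnit_iff, norm_def, hW, ← h, div_self hm0, norm_one]
  obtain ⟨X, hX⟩ := hdiv x hx
  obtain ⟨Y, hY⟩ := hdiv y hy
  obtain ⟨Z, hZ⟩ := hdiv z hz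
  refine ⟨X, Y, Z, hm.imp (hone x X hX) (Or.imp (hone y Y hY) (hone z Z hZ)), PadicInt.ext ?_⟩
  simp only [coe_add, coe_mul, coe_pow, hX, hY, hZ]
  field_simp
  exact h

lemma hilbertSym_two_imp {a b : ℤ_[2]} (h : hilbertSym ℚ_[2] a b = 1) :
    ∃ x y z : ZMod (2 ^ 3), (x ^ 2 = 1 ∨ y ^ 2 = 1 ∨ z ^ 2 = 1) ∧
      z ^ 2 = toZModPow 3 a * x ^ 2 + toZModPow 3 b * y ^ 2 := by
  obtain ⟨x, y, z, hu, h⟩ := exists_primitive_of_hilbertSym_eq_one h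
  have key : ∀ x : ℤ_[2], IsUnit x → toZModPow 3 x ^ 2 = 1 := by
    intro x hx
    obtain ⟨u, hu⟩ := hx.map (toZModPow (p := 2) 3)
    have : ∀ u : (ZMod (2 ^ 3))ˣ, (u : ZMod (2 ^ 3)) ^ 2 = 1 := by decide
    rw [← hu, this]
  exact ⟨toZModPow 3 x, toZModPow 3 y, toZModPow 3 z, hu.imp (key x) (Or.imp (key y) (key z)),
    by simpa using congrArg (toZModPow 3) h⟩

lemma isSquare_toZMod_of_hilbertSym_p {v : ℤ_[p]} (hv : IsUnit v)
    (h : hilbertSym ℚ_[p] ((p : ℤ_[p]) : ℚ_[p]) v = 1) : IsSquare (toZMod v) := by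
  obtain ⟨x, y, z, hu, h⟩ := exists_primitive_of_hilbertSym_eq_one h
  have hmod : toZMod z ^ 2 = toZMod v * toZMod y ^ 2 := by
    simpa using congrArg (toZMod (p := p)) h
  have hv' := (isUnit_iff_toZMod_ne_zero v).mp hv
  by_cases hy : toZMod y = 0
  · exfalso
    have hz : toZMod z = 0 := by simpa [hy] using hmod
    have hx : ¬ toZMod x = 0 := by
      simp only [isUnit_iff_toZMod_ne_zero] at hu
      tauto
    rw [toZMod_eq_zero_iff_norm_lt_one, norm_lt_one_iff_dvd] at hy hz
    obtain ⟨y, rfl⟩ := hy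
    obtain ⟨z, rfl⟩ := hz
    have hp0 : (p : ℤ_[p]) ≠ 0 := Nat.cast_ne_zero.mpr (Fact.out : p.Prime).ne_zero
    have : x ^ 2 = p * (z ^ 2 - v * y ^ 2) := mul_left_cancel₀ hp0 (by linear_combination -h)
    have := congrArg (toZMod (p := p)) this
    simp at this
    exact hx this
  · refine ⟨toZMod z / toZMod y, ?_⟩
    field_simp
    exact hmod.symm

lemma hilbertMultiplicative_padic_of_units
    (H : ∀ b : ℚ_[p], b ≠ 0 → (∀ u : ℤ_[p]ˣ, hilbertSym ℚ_[p] (u : ℤ_[p]) b = 1) ∨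
      (∃ w : ℤ_[p]ˣ, hilbertSym ℚ_[p] (p * (w : ℤ_[p])) b = 1) ∧
        ∀ u u' : ℤ_[p]ˣ, hilbertSym ℚ_[p] (u : ℤ_[p]) b = -1 →
          hilbertSym ℚ_[p] (u' : ℤ_[p]) b = -1 →
          hilbertSym ℚ_[p] ((u * u' : ℤ_[p]ˣ) : ℤ_[p]) b = 1) :
    HilbertMultiplicative ℚ_[p] := by
  have hp0 : (p : ℚ_[p]) ≠ 0 := Nat.cast_ne_zero.mpr (Fact.out : p.Prime).ne_zero
  refine hilbertMultiplicative_of_neg_one fun a a' b ha ha' hb h h' => ?_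
  rcases H b hb with H | ⟨⟨w, hw⟩, H⟩
  · have key : ∀ a : ℚ_[p], a ≠ 0 → hilbertSym ℚ_[p] a b = -1 →
        ∃ (u : ℤ_[p]ˣ) (c : ℚ_[p]), c ≠ 0 ∧ a = p * ((u : ℤ_[p]) : ℚ_[p]) * c ^ 2 := by
      intro a ha h
      obtain ⟨u, c, hc, rfl | h1⟩ := Padic.exists_unit_mul_sq ha
      · rw [hilbertSym_mul_sq_left _ _ hc, H u] at h
        norm_num at h
      · exact ⟨u, c, hc, h1⟩
    obtain ⟨u, c, hc, rfl⟩ := key a ha h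
    obtain ⟨u', c', hc', rfl⟩ := key a' ha' h'
    rw [← H (u * u'), ← hilbertSym_mul_sq_left (((u * u' : ℤ_[p]ˣ) : ℤ_[p]) : ℚ_[p]) b
      (mul_ne_zero hp0 (mul_ne_zero hc hc'))]
    congr 1
    push_cast
    ring
  · have key : ∀ a : ℚ_[p], a ≠ 0 → ∃ u : ℤ_[p]ˣ, ∀ z,
        hilbertSym ℚ_[p] (a * z) b = hilbertSym ℚ_[p] ((u : ℤ_[p]) * z) b := by
      intro a ha
      obtain ⟨u, c, hc, rfl | rfl⟩ := Padic.exists_unit_mul_sq ha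
      · exact ⟨u, fun z => by rw [mul_right_comm, hilbertSym_mul_sq_left _ _ hc]⟩
      · refine ⟨w * u, fun z => ?_⟩
        have hw0 : (p * ((w : ℤ_[p]) : ℚ_[p])) ≠ 0 :=
          mul_ne_zero hp0 (by simp)
        rw [← hilbertSym_mul_of_eq_one hw0 hb hw,
          ← hilbertSym_mul_sq_left ((((w * u : ℤ_[p]ˣ) : ℤ_[p]) : ℚ_[p]) * z) b
            (mul_ne_zero hp0 hc)]
        congr 1
        push_cast
        ring
    obtain ⟨u, hu⟩ := key a ha
    obtain ⟨u', hu'⟩ := key a' ha'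
    have h1 := hu 1
    have h2 := hu' 1
    simp only [mul_one] at h1 h2
    rw [hu, mul_comm, hu', mul_comm]
    simpa using H u u' (h1 ▸ h) (h2 ▸ h')

theorem hilbertMultiplicative_padic_of_ne_two (hp : p ≠ 2) : HilbertMultiplicative ℚ_[p] := by
  refine hilbertMultiplicative_padic_of_units fun b hb => ?_
  obtain ⟨w, c, hc, rfl | rfl⟩ := Padic.exists_unit_mul_sq hb <;>
    simp only [hilbertSym_mul_sq_right _ _ hc]
  · exact Or.inl fun u => hilbertSym_units hp u.isUnit w.isUnit
  · refine Or.inr ⟨⟨-w, by simpa using hilbertSym_neg_self_left (p * ((w : ℤ_[p]) : ℚ_[p]))⟩,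
      fun u u' h h' => ?_⟩
    have key : ∀ u : ℤ_[p]ˣ, hilbertSym ℚ_[p] (u : ℤ_[p]) (p * (w : ℤ_[p])) = -1 →
        quadraticChar (ZMod p) (toZMod (u : ℤ_[p])) = -1 := by
      intro u h
      rw [quadraticChar_neg_one_iff_not_isSquare]
      intro hs
      have := hilbertSym_unit_of_isSquare_toZMod hp u.isUnit hs (p * w)
      push_cast at this
      rw [this] at h
      norm_num at h
    have := hilbertSym_unit_of_isSquare_toZMod hp (u * u').isUnit (b := p * w) ?_
    · push_cast at this ⊢
      exact this
    · rw [← quadraticChar_one_iff_isSquare (toZMod_unit_ne_zero _), Units.val_mul, map_mul, map_mul,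
        key u h, key u' h']
      norm_num

lemma toZModPow_three_unit (u : ℤ_[2]ˣ) : toZModPow 3 (u : ℤ_[2]) ^ 2 = 1 := by
  have : ∀ v : (ZMod (2 ^ 3))ˣ, (v : ZMod (2 ^ 3)) ^ 2 = 1 := by decide
  simpa using this (Units.map (toZModPow (p := 2) 3).toMonoidHom u)

lemma hilbertSym_two_mul_eq_one {b : ℤ_[2]}
    (H : ∀ U U' : ZMod (2 ^ 3), U ^ 2 = 1 → U' ^ 2 = 1 →
      (¬ ∃ x y, U * x ^ 2 + toZModPow 3 b * y ^ 2 = 1) →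
      (¬ ∃ x y, U' * x ^ 2 + toZModPow 3 b * y ^ 2 = 1) →
      ∃ x y, U * U' * x ^ 2 + toZModPow 3 b * y ^ 2 = 1)
    (u u' : ℤ_[2]ˣ) (h : hilbertSym ℚ_[2] (u : ℤ_[2]) b = -1)
    (h' : hilbertSym ℚ_[2] (u' : ℤ_[2]) b = -1) :
    hilbertSym ℚ_[2] ((u * u' : ℤ_[2]ˣ) : ℤ_[2]) b = 1 := by
  have key : ∀ u : ℤ_[2]ˣ, hilbertSym ℚ_[2] (u : ℤ_[2]) b = -1 →
      ¬ ∃ x y, toZModPow 3 (u : ℤ_[2]) * x ^ 2 + toZModPow 3 b * y ^ 2 = 1 := by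
    rintro u h ⟨x, y, hxy⟩
    rw [hilbertSym_two_eq_one hxy] at h
    norm_num at h
  obtain ⟨x, y, hxy⟩ := H _ _ (toZModPow_three_unit u) (toZModPow_three_unit u')
    (key u h) (key u' h')
  exact hilbertSym_two_eq_one (x := x) (y := y) (by rw [Units.val_mul, map_mul, hxy])

theorem hilbertMultiplicative_padic_two : HilbertMultiplicative ℚ_[2] := by
  refine hilbertMultiplicative_padic_of_units fun b hb => ?_
  obtain ⟨w, c, hc, rfl | rfl⟩ := Padic.exists_unit_mul_sq hb <;>
    simp only [hilbertSym_mul_sq_right _ _ hc]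
  · have hw := toZModPow_three_unit w
    have hcases : ∀ W : ZMod (2 ^ 3), W ^ 2 = 1 → W = 1 ∨ W = 5 ∨ W = 3 ∨ W = 7 := by decide
    rcases hcases _ hw with h | h | h | h
    · left
      intro u
      exact hilbertSym_two_eq_one (x := 0) (y := 1) (by rw [h]; ring)
    · left
      intro u
      have : ∀ U : ZMod (2 ^ 3), U ^ 2 = 1 → U * 2 ^ 2 + 5 * 1 ^ 2 = 1 := by decide
      exact hilbertSym_two_eq_one (x := 2) (y := 1) (by rw [h, this _ (toZModPow_three_unit u)])
    · refine Or.inr ⟨⟨-1, ?_⟩, hilbertSym_two_mul_eq_one ?_⟩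
      · have := hilbertSym_two_eq_one (a := 2 * (-1 : ℤ_[2]ˣ)) (b := w) (x := 1) (y := 1)
          (by rw [h, map_mul, map_ofNat]; simp; decide)
        push_cast at this ⊢
        exact this
      · rw [h]
        decide
    · refine Or.inr ⟨⟨1, ?_⟩, hilbertSym_two_mul_eq_one ?_⟩
      · have := hilbertSym_two_eq_one (a := 2 * (1 : ℤ_[2]ˣ)) (b := w) (x := 1) (y := 1)
          (by rw [h, map_mul, map_ofNat]; simp; decide)
        push_cast at this ⊢
        exact this
      · rw [h]
        decide
  · refine Or.inr ⟨⟨-w, ?_⟩, fun u u' h h' => ?_⟩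
    · simpa using hilbertSym_neg_self_left (((2 : ℕ) : ℚ_[2]) * ((w : ℤ_[2]) : ℚ_[2]))
    · have := hilbertSym_two_mul_eq_one (b := (2 : ℕ) * w) ?_ u u'
        (by rwa [coe_mul, coe_natCast]) (by rwa [coe_mul, coe_natCast])
      · rwa [coe_mul, coe_natCast] at this
      · have hw := toZModPow_three_unit w
        rw [map_mul, map_natCast]
        generalize toZModPow 3 (w : ℤ_[2]) = W at hw
        revert W
        decide

theorem hilbertMultiplicative_padic : HilbertMultiplicative ℚ_[p] := by
  rcases eq_or_ne p 2 with rfl | hp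
  · convert hilbertMultiplicative_padic_two
  · exact hilbertMultiplicative_padic_of_ne_two hp

end Local

section Global

open Filter

lemma hilbertSym_real (a b : ℝ) : hilbertSym ℝ a b = if a < 0 ∧ b < 0 then -1 else 1 := by
  have key : ∀ a b : ℝ, 0 ≤ a → hilbertSym ℝ a b = 1 := by
    intro a b ha
    rw [← Real.sq_sqrt ha]
    exact hilbertSym_sq_left b
  split_ifs with h
  · rw [hilbertSym_eq_neg_one_iff, hilbertSym_eq_one_iff]
    rintro ⟨x, y, z, h0, hz⟩
    have hx := mul_nonneg (neg_nonneg.mpr h.1.le) (sq_nonneg x)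
    have hy := mul_nonneg (neg_nonneg.mpr h.2.le) (sq_nonneg y)
    have hz' := sq_nonneg z
    have ex : a * x ^ 2 = 0 := by linarith
    have ey : b * y ^ 2 = 0 := by linarith
    have ez : z ^ 2 = 0 := by linarith
    simp [h.1.ne, h.2.ne] at ex ey ez
    exact h0 (by rw [ex, ey, ez])
  · rcases lt_or_ge a 0 with ha | ha
    · rw [hilbertSym_comm]
      exact key b a (not_lt.mp fun hb => h ⟨ha, hb⟩)
    · exact key a b ha

theorem hilbertMultiplicative_real : HilbertMultiplicative ℝ := by
  refine hilbertMultiplicative_of_neg_one fun a a' b _ _ _ h h' => ?_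
  simp only [hilbertSym_real] at h h' ⊢
  split_ifs at h h' ⊢ with h1 h2 h3
  · exact absurd h1.1 (mul_pos_of_neg_of_neg h2.1 h3.1).le.not_gt
  all_goals simp_all

lemma hilbertSym_map {K L : Type*} [Field K] [Field L] (f : K →+* L) {a b : K}
    (h : hilbertSym K a b = 1) : hilbertSym L (f a) (f b) = 1 := by
  obtain ⟨x, y, z, h0, h⟩ := hilbertSym_eq_one_iff.mp h
  refine hilbertSym_eq_one_iff.mpr ⟨f x, f y, f z, ?_, by simpa using congrArg f h⟩
  simpa using h0

/-- Hilbert's product formula for `a` and `b`: the product of the real symbol and the symbols at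
any large enough finite set of primes is `1`. -/
def HilbertProductFormula (a b : ℚ) : Prop :=
  ∀ᶠ S : Finset Nat.Primes in atTop,
    hilbertSym ℝ a b * ∏ l ∈ S, hilbertSym ℚ_[(l : ℕ)] a b = 1

namespace HilbertProductFormula

lemma symm {a b : ℚ} (h : HilbertProductFormula a b) : HilbertProductFormula b a := by
  refine h.mono fun S hS => ?_
  rw [hilbertSym_comm, Finset.prod_congr rfl fun l _ => hilbertSym_comm _ _]
  exact hS

lemma mul_left {a a' b : ℚ} (ha : a ≠ 0) (ha' : a' ≠ 0) (hb : b ≠ 0)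
    (h : HilbertProductFormula a b) (h' : HilbertProductFormula a' b) :
    HilbertProductFormula (a * a') b := by
  filter_upwards [h, h'] with S hS hS'
  have e : ∀ l : Nat.Primes, hilbertSym ℚ_[(l : ℕ)] ((a * a' : ℚ) : ℚ_[(l : ℕ)]) b =
      hilbertSym ℚ_[(l : ℕ)] a b * hilbertSym ℚ_[(l : ℕ)] a' b := fun l => by
    rw [Rat.cast_mul]
    exact hilbertMultiplicative_padic _ _ _ (Rat.cast_ne_zero.mpr ha) (Rat.cast_ne_zero.mpr ha')
      (Rat.cast_ne_zero.mpr hb)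
  rw [Finset.prod_congr rfl fun l _ => e l, Finset.prod_mul_distrib, Rat.cast_mul,
    hilbertMultiplicative_real _ _ _ (Rat.cast_ne_zero.mpr ha) (Rat.cast_ne_zero.mpr ha')
      (Rat.cast_ne_zero.mpr hb), mul_mul_mul_comm, hS, hS', one_mul]

lemma of_mul_sq {a b c : ℚ} (hc : c ≠ 0) (h : HilbertProductFormula (a * c ^ 2) b) :
    HilbertProductFormula a b := by
  refine h.mono fun S hS => ?_
  have e : ∀ l : Nat.Primes, hilbertSym ℚ_[(l : ℕ)] ((a * c ^ 2 : ℚ) : ℚ_[(l : ℕ)]) b =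
      hilbertSym ℚ_[(l : ℕ)] a b := fun l => by
    rw [Rat.cast_mul, Rat.cast_pow, hilbertSym_mul_sq_left _ _ (Rat.cast_ne_zero.mpr hc)]
  rwa [Finset.prod_congr rfl fun l _ => e l, Rat.cast_mul, Rat.cast_pow,
    hilbertSym_mul_sq_left _ _ (Rat.cast_ne_zero.mpr hc)] at hS

lemma of_rat {a b : ℚ} (h : hilbertSym ℚ a b = 1) : HilbertProductFormula a b := by
  refine Eventually.of_forall fun S => ?_
  have e : ∀ l ∈ S, hilbertSym ℚ_[(l : ℕ)] a b = 1 := fun l _ =>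
    hilbertSym_map (Rat.castHom ℚ_[(l : ℕ)]) h
  rw [Finset.prod_eq_one e, mul_one]
  exact hilbertSym_map (Rat.castHom ℝ) h

lemma of_finset {a b : ℚ} (T : Finset Nat.Primes)
    (hT : ∀ l : Nat.Primes, l ∉ T → hilbertSym ℚ_[(l : ℕ)] a b = 1)
    (h : hilbertSym ℝ a b * ∏ l ∈ T, hilbertSym ℚ_[(l : ℕ)] a b = 1) :
    HilbertProductFormula a b := by
  filter_upwards [eventually_ge_atTop T] with S hS
  rwa [← Finset.prod_subset hS fun l _ hl => hT l hl]

end HilbertProductFormula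

lemma PadicInt.isUnit_intCast {p : ℕ} [Fact p.Prime] {k : ℤ} (h : ¬ (p : ℤ) ∣ k) :
    IsUnit (k : ℤ_[p]) := by
  rw [PadicInt.isUnit_iff_toZMod_ne_zero, map_intCast]
  rwa [ne_eq, ZMod.intCast_zmod_eq_zero_iff_dvd]

lemma hilbertSym_padic_units {p : ℕ} [Fact p.Prime] (hp : p ≠ 2) {a b : ℤ}
    (ha : ¬ (p : ℤ) ∣ a) (hb : ¬ (p : ℤ) ∣ b) :
    hilbertSym ℚ_[p] ((a : ℚ) : ℚ_[p]) ((b : ℚ) : ℚ_[p]) = 1 := by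
  simpa using hilbertSym_units hp (PadicInt.isUnit_intCast ha) (PadicInt.isUnit_intCast hb)

lemma hilbertSym_padic_prime {p : ℕ} [Fact p.Prime] (hp : p ≠ 2) {a : ℤ} (ha : ¬ (p : ℤ) ∣ a) :
    hilbertSym ℚ_[p] ((a : ℚ) : ℚ_[p]) (((p : ℤ) : ℚ) : ℚ_[p]) = legendreSym p a := by
  have ha' : (a : ZMod p) ≠ 0 := by rwa [ne_eq, ZMod.intCast_zmod_eq_zero_iff_dvd]
  by_cases h : IsSquare (a : ZMod p)
  · rw [(legendreSym.eq_one_iff p ha').mpr h]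
    simpa using hilbertSym_unit_of_isSquare_toZMod hp (PadicInt.isUnit_intCast ha) (by simpa)
      (p : ℤ_[p])
  · rw [(legendreSym.eq_neg_one_iff p).mpr h, hilbertSym_eq_neg_one_iff, hilbertSym_comm]
    intro h1
    have := isSquare_toZMod_of_hilbertSym_p (PadicInt.isUnit_intCast ha) (by simpa using h1)
    exact h (by simpa using this)

lemma hilbertSym_padic_two_eq_one {a b : ℤ} {A B : ZMod (2 ^ 3)} (ha : (a : ZMod (2 ^ 3)) = A)
    (hb : (b : ZMod (2 ^ 3)) = B) (h : ∃ x y, A * x ^ 2 + B * y ^ 2 = 1) :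
    hilbertSym ℚ_[2] ((a : ℚ) : ℚ_[2]) ((b : ℚ) : ℚ_[2]) = 1 := by
  obtain ⟨x, y, h⟩ := h
  simpa using hilbertSym_two_eq_one (a := a) (b := b) (x := x) (y := y) (by simpa [ha, hb] using h)

lemma hilbertSym_padic_two_eq_neg_one {a b : ℤ} {A B : ZMod (2 ^ 3)}
    (ha : (a : ZMod (2 ^ 3)) = A) (hb : (b : ZMod (2 ^ 3)) = B)
    (h : ¬ ∃ x y z, (x ^ 2 = 1 ∨ y ^ 2 = 1 ∨ z ^ 2 = 1) ∧ z ^ 2 = A * x ^ 2 + B * y ^ 2) :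
    hilbertSym ℚ_[2] ((a : ℚ) : ℚ_[2]) ((b : ℚ) : ℚ_[2]) = -1 := by
  rw [hilbertSym_eq_neg_one_iff]
  intro h1
  have := hilbertSym_two_imp (a := a) (b := b) (by simpa using h1)
  rw [map_intCast, map_intCast, ha, hb] at this
  exact h this

lemma intCast_zmod_eight {q : ℕ} {r : ℕ} (h : q % 8 = r) :
    (((q : ℕ) : ℤ) : ZMod (2 ^ 3)) = (r : ZMod (2 ^ 3)) := by
  rw [← h, Int.cast_natCast]
  exact (ZMod.natCast_mod q (2 ^ 3)).symm

lemma intCast_zmod_eight_eq_one_or_of_mod_four_eq_one {q : ℕ} (h : q % 4 = 1) :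
    ((q : ℤ) : ZMod (2 ^ 3)) = 1 ∨ ((q : ℤ) : ZMod (2 ^ 3)) = 5 := by
  rcases (by omega : q % 8 = 1 ∨ q % 8 = 5) with h | h
  · exact Or.inl (by simpa using intCast_zmod_eight h)
  · exact Or.inr (by simpa using intCast_zmod_eight h)

lemma intCast_zmod_eight_eq_three_or_of_mod_four_eq_three {q : ℕ} (h : q % 4 = 3) :
    ((q : ℤ) : ZMod (2 ^ 3)) = 3 ∨ ((q : ℤ) : ZMod (2 ^ 3)) = 7 := by
  rcases (by omega : q % 8 = 3 ∨ q % 8 = 7) with h | h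
  · exact Or.inl (by simpa using intCast_zmod_eight h)
  · exact Or.inr (by simpa using intCast_zmod_eight h)

lemma hilbertSym_padic_two_of_mod_four_eq_one {p q : ℕ} (hp : p % 4 = 1) (hq : q % 2 = 1) :
    hilbertSym ℚ_[2] (((p : ℤ) : ℚ) : ℚ_[2]) (((q : ℤ) : ℚ) : ℚ_[2]) = 1 := by
  refine hilbertSym_padic_two_eq_one rfl rfl ?_
  have hq' : ((q : ℤ) : ZMod (2 ^ 3)) = 1 ∨ ((q : ℤ) : ZMod (2 ^ 3)) = 5 ∨
      ((q : ℤ) : ZMod (2 ^ 3)) = 3 ∨ ((q : ℤ) : ZMod (2 ^ 3)) = 7 := by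
    rcases (by omega : q % 4 = 1 ∨ q % 4 = 3) with h | h
    · have := intCast_zmod_eight_eq_one_or_of_mod_four_eq_one h
      tauto
    · have := intCast_zmod_eight_eq_three_or_of_mod_four_eq_three h
      tauto
  rcases intCast_zmod_eight_eq_one_or_of_mod_four_eq_one hp with h | h <;>
    rcases hq' with h' | h' | h' | h' <;> rw [h, h'] <;> decide

lemma hilbertSym_padic_two_of_mod_four_eq_three {p q : ℕ} (hp : p % 4 = 3) (hq : q % 4 = 3) :
    hilbertSym ℚ_[2] (((p : ℤ) : ℚ) : ℚ_[2]) (((q : ℤ) : ℚ) : ℚ_[2]) = -1 := by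
  refine hilbertSym_padic_two_eq_neg_one rfl rfl ?_
  rcases intCast_zmod_eight_eq_three_or_of_mod_four_eq_three hp with h | h <;>
    rcases intCast_zmod_eight_eq_three_or_of_mod_four_eq_three hq with h' | h' <;>
      rw [h, h'] <;> decide

/-- The prime `2`. -/
def primeTwo : Nat.Primes := ⟨2, Nat.prime_two⟩

lemma eq_primeTwo {l : Nat.Primes} (h : (l : ℕ) = 2) : l = primeTwo := Subtype.ext h

lemma primeTwo_ne {q : Nat.Primes} (hq : (q : ℕ) ≠ 2) : primeTwo ≠ q :=
  fun e => hq (congrArg Subtype.val e).symm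

lemma Nat.Primes.not_dvd_neg_one (l : Nat.Primes) : ¬ ((l : ℕ) : ℤ) ∣ -1 := fun h =>
  l.2.not_dvd_one (Int.natAbs_dvd_natAbs.mpr h)

lemma Nat.Primes.not_dvd_of_ne {l q : Nat.Primes} (h : l ≠ q) :
    ¬ ((l : ℕ) : ℤ) ∣ ((q : ℕ) : ℤ) := by
  rw [Int.natCast_dvd_natCast, Nat.prime_dvd_prime_iff_eq l.2 q.2]
  exact fun e => h (Subtype.ext e)

namespace HilbertProductFormula

lemma of_int {a b : ℤ} (hab : ¬ (a < 0 ∧ b < 0)) (T : Finset Nat.Primes)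
    (h2 : primeTwo ∈ T)
    (ha : ∀ l : Nat.Primes, l ∉ T → ¬ ((l : ℕ) : ℤ) ∣ a)
    (hb : ∀ l : Nat.Primes, l ∉ T → ¬ ((l : ℕ) : ℤ) ∣ b)
    (h : ∏ l ∈ T, hilbertSym ℚ_[(l : ℕ)] ((a : ℚ) : ℚ_[(l : ℕ)]) ((b : ℚ) : ℚ_[(l : ℕ)]) = 1) :
    HilbertProductFormula a b := by
  refine of_finset T (fun l hl => hilbertSym_padic_units ?_ (ha l hl) (hb l hl)) ?_
  · exact fun h => hl (eq_primeTwo h ▸ h2)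
  · rw [h, mul_one, hilbertSym_real, if_neg]
    exact_mod_cast hab

lemma neg_one_neg_one : HilbertProductFormula ((-1 : ℤ) : ℚ) ((-1 : ℤ) : ℚ) := by
  refine of_finset {primeTwo} (fun l hl => ?_) ?_
  · exact hilbertSym_padic_units (fun h => hl (Finset.mem_singleton.mpr (eq_primeTwo h)))
      l.not_dvd_neg_one l.not_dvd_neg_one
  · have : hilbertSym ℚ_[(primeTwo : ℕ)] (((-1 : ℤ) : ℚ) : ℚ_[(primeTwo : ℕ)])
        (((-1 : ℤ) : ℚ) : ℚ_[(primeTwo : ℕ)]) = -1 :=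
      hilbertSym_padic_two_eq_neg_one rfl rfl (by decide)
    rw [Finset.prod_singleton]
    rw [this, hilbertSym_real, if_pos (by norm_num)]
    norm_num

lemma neg_one_two : HilbertProductFormula ((-1 : ℤ) : ℚ) ((2 : ℤ) : ℚ) :=
  of_rat (hilbertSym_eq_one_iff.mpr ⟨1, 1, 1, by simp, by norm_num⟩)

lemma of_odd_prime {a : ℤ} (q : Nat.Primes) (hq : (q : ℕ) ≠ 2)
    (ha : ∀ l : Nat.Primes, (l : ℕ) ≠ 2 → ¬ ((l : ℕ) : ℤ) ∣ a)
    (h : hilbertSym ℚ_[2] ((a : ℚ) : ℚ_[2]) ((((q : ℕ) : ℤ) : ℚ) : ℚ_[2]) * legendreSym q a = 1) :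
    HilbertProductFormula a (((q : ℕ) : ℤ) : ℚ) := by
  have hq2 := primeTwo_ne hq
  refine of_int (fun h => by omega) {primeTwo, q} (by simp) (fun l hl => ha l ?_)
    (fun l hl => Nat.Primes.not_dvd_of_ne ?_) ?_
  · rintro h
    exact hl (by simp [eq_primeTwo h])
  · rintro rfl
    exact hl (by simp)
  · rw [Finset.prod_pair hq2, hilbertSym_padic_prime hq (ha q hq)]
    exact h

lemma neg_one_prime (q : Nat.Primes) :
    HilbertProductFormula ((-1 : ℤ) : ℚ) (((q : ℕ) : ℤ) : ℚ) := by
  by_cases hq : (q : ℕ) = 2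
  · rw [hq]
    exact neg_one_two
  refine of_odd_prime q hq (fun l _ => l.not_dvd_neg_one) ?_
  rw [legendreSym.at_neg_one hq, ZMod.χ₄_nat_mod_four]
  have := q.2.eq_two_or_odd.resolve_left hq
  rcases (by omega : (q : ℕ) % 8 = 1 ∨ (q : ℕ) % 8 = 3 ∨ (q : ℕ) % 8 = 5 ∨ (q : ℕ) % 8 = 7) with
    h | h | h | h
  · rw [show (q : ℕ) % 4 = 1 by omega,
      hilbertSym_padic_two_eq_one rfl (intCast_zmod_eight h) (by decide)]
    decide
  · rw [show (q : ℕ) % 4 = 3 by omega,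
      hilbertSym_padic_two_eq_neg_one rfl (intCast_zmod_eight h) (by decide)]
    decide
  · rw [show (q : ℕ) % 4 = 1 by omega,
      hilbertSym_padic_two_eq_one rfl (intCast_zmod_eight h) (by decide)]
    decide
  · rw [show (q : ℕ) % 4 = 3 by omega,
      hilbertSym_padic_two_eq_neg_one rfl (intCast_zmod_eight h) (by decide)]
    decide

lemma two_odd_prime (q : Nat.Primes) (hq : (q : ℕ) ≠ 2) :
    HilbertProductFormula ((2 : ℤ) : ℚ) (((q : ℕ) : ℤ) : ℚ) := by
  refine of_odd_prime q hq
    (fun l hl => Nat.Primes.not_dvd_of_ne (primeTwo_ne hl).symm) ?_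
  rw [legendreSym.at_two hq, ZMod.χ₈_nat_mod_eight]
  have := q.2.eq_two_or_odd.resolve_left hq
  rcases (by omega : (q : ℕ) % 8 = 1 ∨ (q : ℕ) % 8 = 3 ∨ (q : ℕ) % 8 = 5 ∨ (q : ℕ) % 8 = 7) with
    h | h | h | h
  · rw [h, hilbertSym_padic_two_eq_one rfl (intCast_zmod_eight h) (by decide)]
    decide
  · rw [h, hilbertSym_padic_two_eq_neg_one rfl (intCast_zmod_eight h) (by decide)]
    decide
  · rw [h, hilbertSym_padic_two_eq_neg_one rfl (intCast_zmod_eight h) (by decide)]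
    decide
  · rw [h, hilbertSym_padic_two_eq_one rfl (intCast_zmod_eight h) (by decide)]
    decide

lemma odd_primes {p q : Nat.Primes} (hp : (p : ℕ) ≠ 2) (hq : (q : ℕ) ≠ 2) (hpq : p ≠ q) :
    HilbertProductFormula (((p : ℕ) : ℤ) : ℚ) (((q : ℕ) : ℤ) : ℚ) := by
  have hp2 := primeTwo_ne hp
  have hq2 := primeTwo_ne hq
  have hpq' : (p : ℕ) ≠ q := fun e => hpq (Subtype.ext e)
  refine of_int (fun h => by omega) {primeTwo, p, q} (by simp)
    (fun l hl => Nat.Primes.not_dvd_of_ne ?_) (fun l hl => Nat.Primes.not_dvd_of_ne ?_) ?_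
  · rintro rfl
    exact hl (by simp)
  · rintro rfl
    exact hl (by simp)
  rw [Finset.prod_insert (by simp [hp2, hq2]), Finset.prod_pair hpq,
    hilbertSym_padic_prime hq (Nat.Primes.not_dvd_of_ne hpq.symm),
    hilbertSym_comm (K := ℚ_[(p : ℕ)]),
    hilbertSym_padic_prime hp (Nat.Primes.not_dvd_of_ne hpq), mul_comm (legendreSym p q),
    legendreSym.quadratic_reciprocity hp hq hpq']
  have hp1 := p.2.eq_two_or_odd.resolve_left hp
  have hq1 := q.2.eq_two_or_odd.resolve_left hq
  rcases (by omega : (p : ℕ) % 4 = 1 ∨ (p : ℕ) % 4 = 3) with h | h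
  · have h2 : hilbertSym ℚ_[(primeTwo : ℕ)] (((p : ℕ) : ℤ) : ℚ) (((q : ℕ) : ℤ) : ℚ) = 1 :=
      hilbertSym_padic_two_of_mod_four_eq_one h hq1
    rw [h2, Even.neg_one_pow, one_mul]
    exact (Nat.even_iff.mpr (by omega)).mul_right _
  rcases (by omega : (q : ℕ) % 4 = 1 ∨ (q : ℕ) % 4 = 3) with h' | h'
  · have h2 : hilbertSym ℚ_[(primeTwo : ℕ)] (((p : ℕ) : ℤ) : ℚ) (((q : ℕ) : ℤ) : ℚ) = 1 :=
      (hilbertSym_comm _ _).trans (hilbertSym_padic_two_of_mod_four_eq_one h' hp1)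
    rw [h2, Even.neg_one_pow, one_mul]
    exact (Nat.even_iff.mpr (by omega)).mul_left _
  · have h2 : hilbertSym ℚ_[(primeTwo : ℕ)] (((p : ℕ) : ℤ) : ℚ) (((q : ℕ) : ℤ) : ℚ) = -1 :=
      hilbertSym_padic_two_of_mod_four_eq_three h h'
    rw [h2, Odd.neg_one_pow]
    · norm_num
    · exact (Nat.odd_iff.mpr (by omega)).mul (Nat.odd_iff.mpr (by omega))

lemma primes (p q : Nat.Primes) :
    HilbertProductFormula (((p : ℕ) : ℤ) : ℚ) (((q : ℕ) : ℤ) : ℚ) := by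
  by_cases hpq : p = q
  · subst hpq
    have h0 : (((p : ℕ) : ℤ) : ℚ) ≠ 0 := by exact_mod_cast p.2.ne_zero
    have := mul_left (neg_ne_zero.mpr h0) (by norm_num) h0
      (of_rat (hilbertSym_neg_self_left _)) (neg_one_prime p)
    simpa using this
  by_cases hp : (p : ℕ) = 2
  · rw [hp]
    exact two_odd_prime q fun hq => hpq (Subtype.ext (hp.trans hq.symm))
  by_cases hq : (q : ℕ) = 2
  · rw [hq]
    exact (two_odd_prime p hp).symm
  exact odd_primes hp hq hpq

lemma of_neg_one_of_primes {b : ℚ} (hb : b ≠ 0) (h1 : HilbertProductFormula ((-1 : ℤ) : ℚ) b)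
    (h : ∀ q : Nat.Primes, HilbertProductFormula (((q : ℕ) : ℤ) : ℚ) b) {a : ℚ} (ha : a ≠ 0) :
    HilbertProductFormula a b := by
  have nat : ∀ m : ℕ, m ≠ 0 → HilbertProductFormula ((m : ℤ) : ℚ) b := by
    intro m
    induction m using induction_on_primes with
    | zero => exact fun h => absurd rfl h
    | one =>
      intro _
      refine of_rat ?_
      simpa using hilbertSym_one_left b
    | prime_mul q m hq ih =>
      intro hm
      have hm' : m ≠ 0 := right_ne_zero_of_mul hm
      have := mul_left (by exact_mod_cast hq.ne_zero) (by exact_mod_cast hm') hb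
        (h ⟨q, hq⟩) (ih hm')
      simpa using this
  have int : ∀ m : ℤ, m ≠ 0 → HilbertProductFormula (m : ℚ) b := by
    intro m hm
    rcases Int.natAbs_eq m with e | e
    · rw [e]
      exact nat _ (Int.natAbs_ne_zero.mpr hm)
    · have := mul_left (by norm_num) (by simpa using hm) hb h1 (nat _ (Int.natAbs_ne_zero.mpr hm))
      rw [e]
      simpa using this
  have hd : (a.den : ℚ) ≠ 0 := by exact_mod_cast a.den_ne_zero
  refine of_mul_sq hd ?_
  have e : a * (a.den : ℚ) ^ 2 = ((a.num * a.den : ℤ) : ℚ) := by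
    push_cast
    rw [pow_two, ← mul_assoc, Rat.mul_den_eq_num]
  rw [e]
  exact int _ (mul_ne_zero (Rat.num_ne_zero.mpr ha) (by exact_mod_cast a.den_ne_zero))

end HilbertProductFormula

theorem hilbertProductFormula {a b : ℚ} (ha : a ≠ 0) (hb : b ≠ 0) : HilbertProductFormula a b := by
  refine HilbertProductFormula.of_neg_one_of_primes hb ?_ (fun q => ?_) ha
  · refine (HilbertProductFormula.of_neg_one_of_primes (by norm_num) ?_ (fun q => ?_) hb).symm
    · exact HilbertProductFormula.neg_one_neg_one
    · exact (HilbertProductFormula.neg_one_prime q).symm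
  · refine (HilbertProductFormula.of_neg_one_of_primes (by exact_mod_cast q.2.ne_zero) ?_
      (fun q' => ?_) hb).symm
    · exact HilbertProductFormula.neg_one_prime q
    · exact HilbertProductFormula.primes q' q

lemma DiagEmbeds.of_equivalent {K : Type*} [Field K] {n : ℕ} {a b : Fin n → K}
    (h : (QuadraticMap.weightedSumSquares K a).Equivalent (QuadraticMap.weightedSumSquares K b)) :
    DiagEmbeds a b := by
  obtain ⟨e⟩ := h
  refine ⟨e.toLinearEquiv.toLinearMap, fun x => ?_⟩
  have := e.map_app x
  simp only [QuadraticMap.weightedSumSquares_apply, smul_eq_mul, ← pow_two] at this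
  exact this

variable {n : ℕ}

lemma EquivAt.epsP_eq {a b : Fin n → ℚ} (ha : ∀ i, a i ≠ 0) (hb : ∀ i, b i ≠ 0) {l : Nat.Primes}
    (h : EquivAt a b l) : epsP a l = epsP b l :=
  (DiagEmbeds.of_equivalent h).hasseInv_eq hilbertMultiplicative_padic
    (fun i => Rat.cast_ne_zero.mpr (ha i)) (fun i => Rat.cast_ne_zero.mpr (hb i))

lemma eventually_epsReal_mul_prod_epsP {a : Fin n → ℚ} (ha : ∀ i, a i ≠ 0) :
    ∀ᶠ S : Finset Nat.Primes in atTop, epsReal a * ∏ l ∈ S, epsP a l = 1 := by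
  have h : ∀ᶠ S : Finset Nat.Primes in atTop, ∀ i j,
      hilbertSym ℝ (a i) (a j) * ∏ l ∈ S, hilbertSym ℚ_[(l : ℕ)] (a i) (a j) = 1 :=
    eventually_all.mpr fun i => eventually_all.mpr fun j => hilbertProductFormula (ha i) (ha j)
  filter_upwards [h] with S hS
  simp only [epsReal, epsP, hasseInv]
  rw [Finset.prod_comm (s := S), ← Finset.prod_mul_distrib]
  refine Finset.prod_eq_one fun i _ => ?_
  rw [Finset.prod_comm (s := S), ← Finset.prod_mul_distrib]
  refine Finset.prod_eq_one fun j _ => ?_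
  split_ifs
  · exact hS i j
  · simp

lemma hasseInv_mul_self {K : Type*} [Field K] (a : Fin n → K) :
    hasseInv K a * hasseInv K a = 1 := by
  simp only [hasseInv, ← Finset.prod_mul_distrib]
  refine Finset.prod_eq_one fun i _ => Finset.prod_eq_one fun j _ => ?_
  split_ifs
  · exact hilbertSym_mul_self _ _
  · simp

theorem epsReal_mul_epsP_eq {a b : Fin n → ℚ} (ha : ∀ i, a i ≠ 0) (hb : ∀ i, b i ≠ 0)
    {p : Nat.Primes} (h : ∀ l : Nat.Primes, l ≠ p → EquivAt a b l) :
    epsReal a * epsP a p = epsReal b * epsP b p := by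
  obtain ⟨S, hSa, hSb, hS⟩ := ((eventually_epsReal_mul_prod_epsP ha).and
    ((eventually_epsReal_mul_prod_epsP hb).and (eventually_ge_atTop {p}))).exists
  have hp : p ∈ S := hS (Finset.mem_singleton_self p)
  rw [← Finset.mul_prod_erase S _ hp, ← mul_assoc] at hSa hSb
  have e : ∏ l ∈ S.erase p, epsP a l = ∏ l ∈ S.erase p, epsP b l :=
    Finset.prod_congr rfl fun l hl => (h l (Finset.ne_of_mem_erase hl)).epsP_eq ha hb
  rw [e] at hSa
  exact mul_right_cancel₀ (right_ne_zero_of_mul_eq_one hSb) (hSa.trans hSb.symm)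

lemma negIndex_cons (c : ℚ) (a : Fin n → ℚ) :
    negIndex (Fin.cons c a : Fin (n + 1) → ℚ) = (if c < 0 then 1 else 0) + negIndex a := by
  simp only [negIndex, Finset.card_filter, Fin.sum_univ_succ, Fin.cons_zero, Fin.cons_succ]

lemma prod_ite_neg (a : Fin n → ℚ) :
    (∏ i, if a i < 0 then (-1 : ℤ) else 1) = (-1) ^ negIndex a := by
  rw [Finset.prod_ite, Finset.prod_const, Finset.prod_const_one, mul_one, negIndex]

lemma epsReal_eq (a : Fin n → ℚ) : epsReal a = (-1) ^ (negIndex a).choose 2 := by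
  induction n with
  | zero => simp [epsReal, hasseInv, negIndex]
  | succ n ih =>
    obtain ⟨c, a, rfl⟩ : ∃ c a', a = Fin.cons c a' := ⟨a 0, Fin.tail a, (Fin.cons_self_tail a).symm⟩
    have e : (fun i => ((Fin.cons c a : Fin (n + 1) → ℚ) i : ℝ)) =
        Fin.cons (c : ℝ) fun i => (a i : ℝ) := by
      funext i
      refine Fin.cases rfl (fun i => rfl) i
    have ih := ih a
    rw [epsReal] at ih
    rw [epsReal, e, hasseInv_cons, ih, negIndex_cons]
    simp only [hilbertSym_real, Rat.cast_lt_zero]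
    by_cases hc : c < 0
    · simp only [hc, true_and, if_true, prod_ite_neg]
      rw [add_comm 1, Nat.choose_succ_succ', Nat.choose_one_right, pow_add]
    · simp [hc]

lemma even_negIndex {a : Fin n → ℚ} (h : 0 < ∏ i, a i) : Even (negIndex a) := by
  by_contra hodd
  have e : ∏ i, a i = (-1) ^ negIndex a * ∏ i, |a i| := by
    have := congrArg (Int.cast : ℤ → ℚ) (prod_ite_neg a)
    push_cast at this
    rw [← this, ← Finset.prod_mul_distrib]
    refine Finset.prod_congr rfl fun i _ => ?_
    split_ifs with hi
    · rw [abs_of_neg hi]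
      ring
    · rw [abs_of_nonneg (not_lt.mp hi), one_mul]
  rw [(Nat.not_even_iff_odd.mp hodd).neg_one_pow] at e
  have := Finset.prod_nonneg fun (i : Fin n) (_ : i ∈ Finset.univ) => abs_nonneg (a i)
  linarith

lemma epsReal_eq_one_iff {a : Fin n → ℚ} (h : 0 < ∏ i, a i) :
    epsReal a = 1 ↔ 4 ∣ negIndex a := by
  obtain ⟨m, hm⟩ := even_iff_two_dvd.mp (even_negIndex h)
  have e : (negIndex a).choose 2 = m * (2 * m - 1) := by
    rw [Nat.choose_two_right, hm, mul_assoc, Nat.mul_div_cancel_left _ two_pos]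
  rw [epsReal_eq, neg_one_pow_eq_one_iff_even (by norm_num), e, Nat.even_mul, hm]
  rcases Nat.eq_zero_or_pos m with rfl | hm0
  · simp
  · rw [Nat.even_iff, Nat.even_iff]
    omega

end Global

/-- Let `q₁ = ⟨a i⟩` and `q₂ = ⟨b i⟩` be non-degenerate quadratic
forms over `ℚ` of the same rank and `p` a prime. If `q₁ ⊗ ℚ_ℓ ≅ q₂ ⊗ ℚ_ℓ` for all
primes `ℓ ≠ p` and the common discriminant is positive, then `4 ∣ s₋(q₁)` if and
only if `ε_p(q₁) = ε_ℝ(q₂)·ε_p(q₂)`. -/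
theorem four_dvd_negIndex_iff_eps {n : ℕ} (a b : Fin n → ℚ) (ha : ∀ i, a i ≠ 0)
    (hb : ∀ i, b i ≠ 0) (p : Nat.Primes)
    (hloc : ∀ l : Nat.Primes, l ≠ p → EquivAt a b l)
    (hda : 0 < ∏ i, a i) (hdb : 0 < ∏ i, b i) :
    4 ∣ negIndex a ↔ epsP a p = epsReal b * epsP b p := by
  rw [← epsReal_eq_one_iff hda, ← epsReal_mul_epsP_eq ha hb hloc]
  have h : epsP a p ≠ 0 := left_ne_zero_of_mul_eq_one (hasseInv_mul_self _)
  rw [eq_comm (a := epsP a p), mul_eq_right₀ h]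

end
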